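/- Let G be a finite simple graph with at least one perfect matching. Then F_f(G) ≥ F(G), i.e., the maximum of f_f(G,γ) over all fractional perfect matchings γ of G is at least the maximum of f(G,M) over all perfect matchings M of G. -/

import Mathlib

open Finset

variable {V : Type} [Fintype V] [DecidableEq V]

/-- The sum of `γ` over the edges of `G` incident with the vertex `v`.
(Functions on `E(G)` are encoded as functions on `Sym2 V` vanishing off the edge set.) -/
def vertexSum (G : SimpleGraph V) [DecidableRel G.Adj] (γ : Sym2 V → ℝ) (v : V) : ℝ :=
  ∑ e ∈ G.edgeFinset, if v ∈ e then γ e else 0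

/-- `γ` is a fractional perfect matching of `G`. -/
def IsFPM (G : SimpleGraph V) [DecidableRel G.Adj] (γ : Sym2 V → ℝ) : Prop :=
  (∀ e, 0 ≤ γ e) ∧ (∀ e ∉ G.edgeSet, γ e = 0) ∧ ∀ v, vertexSum G γ v = 1

/-- `α ↑ γ` : `α` is a (nonnegative) forcing function for the fractional perfect matching
`γ`, i.e. `α ⪯ γ` and `γ` is the unique fractional perfect matching `γ'` with `α ⪯ γ'`. -/
def IsForcing (G : SimpleGraph V) [DecidableRel G.Adj] (α γ : Sym2 V → ℝ) : Prop :=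
  (∀ e, 0 ≤ α e) ∧ (∀ e ∉ G.edgeSet, α e = 0) ∧ α ≤ γ ∧
    ∀ γ', IsFPM G γ' → α ≤ γ' → γ' = γ

/-- `|α|`, the sum of the values of `α` over all edges of `G`. -/
def eSum (G : SimpleGraph V) [DecidableRel G.Adj] (α : Sym2 V → ℝ) : ℝ :=
  ∑ e ∈ G.edgeFinset, α e

/-- The fractional forcing number `f_f(G,γ) = min {|α| : α ↑ γ}`. -/
noncomputable def ffN (G : SimpleGraph V) [DecidableRel G.Adj] (γ : Sym2 V → ℝ) : ℝ :=
  sInf {x : ℝ | ∃ α, IsForcing G α γ ∧ x = eSum G α}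

/-- `f_f(G)`, the minimum of `f_f(G,γ)` over all fractional perfect matchings `γ`. -/
noncomputable def ffMin (G : SimpleGraph V) [DecidableRel G.Adj] : ℝ :=
  sInf {x : ℝ | ∃ γ, IsFPM G γ ∧ ffN G γ = x}

/-- `F_f(G)`, the maximum of `f_f(G,γ)` over all fractional perfect matchings `γ`. -/
noncomputable def ffMax (G : SimpleGraph V) [DecidableRel G.Adj] : ℝ :=
  sSup {x : ℝ | ∃ γ, IsFPM G γ ∧ ffN G γ = x}

/-- `M` is a perfect matching of `G`: a set of pairwise disjoint edges covering every
vertex, i.e. every vertex lies in exactly one edge of `M`. -/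
def IsPM (G : SimpleGraph V) (M : Finset (Sym2 V)) : Prop :=
  ↑M ⊆ G.edgeSet ∧ ∀ v : V, ∃! e, e ∈ M ∧ v ∈ e

/-- The characteristic function `𝟙_M` of a set of edges `M`. -/
def charF (M : Finset (Sym2 V)) : Sym2 V → ℝ := fun e => if e ∈ M then 1 else 0

/-- `S` is a forcing set for the perfect matching `M`: `S ⊆ M` and `M` is the unique
perfect matching of `G` containing `S`. -/
def IsForcingSet (G : SimpleGraph V) (S : Set (Sym2 V)) (M : Finset (Sym2 V)) : Prop :=
  S ⊆ ↑M ∧ ∀ M', IsPM G M' → S ⊆ ↑M' → M' = M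

/-- The forcing number `f(G,M)`: the minimum size of a forcing set for `M`. -/
noncomputable def fN (G : SimpleGraph V) (M : Finset (Sym2 V)) : ℕ :=
  sInf {n : ℕ | ∃ S : Finset (Sym2 V), IsForcingSet G ↑S M ∧ S.card = n}

/-- `F(G)`, the maximum of `f(G,M)` over all perfect matchings `M` of `G`. -/
noncomputable def fMax (G : SimpleGraph V) : ℕ :=
  sSup {n : ℕ | ∃ M, IsPM G M ∧ fN G M = n}

theorem IsPM.isFPM_charF {G : SimpleGraph V} [DecidableRel G.Adj] {M : Finset (Sym2 V)}
    (hM : IsPM G M) : IsFPM G (charF M) := by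
  refine ⟨fun e => ?_, fun e he => if_neg fun h => he (hM.1 h), fun v => ?_⟩
  · unfold charF
    split_ifs <;> norm_num
  · obtain ⟨e, ⟨heM, hve⟩, huniq⟩ := hM.2 v
    unfold vertexSum
    rw [Finset.sum_eq_single e]
    · simp [charF, heM, hve]
    · intro e' _ hne
      by_cases hv : v ∈ e'
      · have : e' ∉ M := fun h => hne (huniq e' ⟨h, hv⟩)
        simp [charF, this]
      · simp [hv]
    · exact fun h => absurd (SimpleGraph.mem_edgeFinset.2 (hM.1 heM)) h

theorem charF_injective {W : Type} [DecidableEq W] :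
    Function.Injective (charF : Finset (Sym2 W) → Sym2 W → ℝ) := by
  intro M N h
  ext e
  have := congrFun h e
  by_cases hM : e ∈ M <;> by_cases hN : e ∈ N <;> simp_all [charF]

/-- A fractional perfect matching is a forcing function for itself. -/
theorem IsFPM.isForcing_self {G : SimpleGraph V} [DecidableRel G.Adj] {γ : Sym2 V → ℝ}
    (hγ : IsFPM G γ) : IsForcing G γ γ := by
  refine ⟨hγ.1, hγ.2.1, le_rfl, fun γ' hγ' hle => funext fun e => ?_⟩
  by_cases he : e ∈ G.edgeSet
  · obtain ⟨v, hv⟩ : ∃ v, v ∈ e := ⟨_, e.out_fst_mem⟩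
    have hsum := (hγ.2.2 v).trans (hγ'.2.2 v).symm
    unfold vertexSum at hsum
    rw [Finset.sum_eq_sum_iff_of_le] at hsum
    · have := hsum e (SimpleGraph.mem_edgeFinset.2 he)
      simpa [hv] using this.symm
    · intro e' _
      split_ifs
      exacts [hle e', le_rfl]
  · rw [hγ.2.1 e he, hγ'.2.1 e he]

theorem IsFPM.eSum_le_card {G : SimpleGraph V} [DecidableRel G.Adj] {γ : Sym2 V → ℝ}
    (hγ : IsFPM G γ) : eSum G γ ≤ Fintype.card V := by
  have hcard : (Fintype.card V : ℝ) = ∑ v, vertexSum G γ v := by simp [hγ.2.2]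
  rw [hcard]
  unfold vertexSum eSum
  rw [Finset.sum_comm]
  refine Finset.sum_le_sum fun e _ => ?_
  have hnonneg : ∀ v ∈ (univ : Finset V), 0 ≤ if v ∈ e then γ e else 0 := by
    intro v _
    split_ifs
    exacts [hγ.1 e, le_rfl]
  simpa [e.out_fst_mem] using Finset.single_le_sum hnonneg (Finset.mem_univ (Quot.out e).1)

theorem IsForcing.eSum_nonneg {G : SimpleGraph V} [DecidableRel G.Adj] {α γ : Sym2 V → ℝ}
    (h : IsForcing G α γ) : 0 ≤ eSum G α :=
  Finset.sum_nonneg fun e _ => h.1 e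

theorem IsFPM.ffN_le_card {G : SimpleGraph V} [DecidableRel G.Adj] {γ : Sym2 V → ℝ}
    (hγ : IsFPM G γ) : ffN G γ ≤ Fintype.card V := by
  refine le_trans (csInf_le ⟨0, ?_⟩ ⟨γ, hγ.isForcing_self, rfl⟩) hγ.eSum_le_card
  rintro x ⟨α, hα, rfl⟩
  exact hα.eSum_nonneg

theorem IsFPM.convexCombination {G : SimpleGraph V} [DecidableRel G.Adj] {γ γ' : Sym2 V → ℝ}
    (hγ : IsFPM G γ) (hγ' : IsFPM G γ') {t : ℝ} (ht₀ : 0 ≤ t) (ht₁ : t ≤ 1) :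
    IsFPM G fun e => (1 - t) * γ e + t * γ' e := by
  refine ⟨fun e => ?_, fun e he => by simp [hγ.2.1 e he, hγ'.2.1 e he], fun v => ?_⟩
  · exact add_nonneg (mul_nonneg (sub_nonneg.2 ht₁) (hγ.1 e)) (mul_nonneg ht₀ (hγ'.1 e))
  · have h : vertexSum G (fun e => (1 - t) * γ e + t * γ' e) v =
        (1 - t) * vertexSum G γ v + t * vertexSum G γ' v := by
      unfold vertexSum
      rw [Finset.mul_sum, Finset.mul_sum, ← Finset.sum_add_distrib]
      refine Finset.sum_congr rfl fun e _ => ?_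
      split_ifs <;> simp
    rw [h, hγ.2.2, hγ'.2.2]
    ring

/-- The edges on which a forcing function for `charF M` equals `1` form a forcing set for `M`:
every other edge of `M` leaves room to move a little towards any competing matching. -/
theorem IsForcing.isForcingSet {G : SimpleGraph V} [DecidableRel G.Adj] {α : Sym2 V → ℝ}
    {M : Finset (Sym2 V)} (hM : IsPM G M) (hα : IsForcing G α (charF M)) :
    IsForcingSet G ↑(M.filter fun e => α e = 1) M := by
  refine ⟨Finset.coe_subset.2 (Finset.filter_subset _ _), fun M' hM' hsub => ?_⟩
  have hroom : ∀ e, 0 < if α e < 1 then 1 - α e else 1 := by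
    intro e
    split_ifs <;> linarith
  have hsmall : ∀ᶠ t in nhdsWithin (0 : ℝ) (Set.Ioi 0),
      t ∈ Set.Ioo 0 1 ∧ ∀ e, t ∈ Set.Ioo 0 (if α e < 1 then 1 - α e else 1) :=
    Filter.Eventually.and (Ioo_mem_nhdsGT one_pos)
      (Filter.eventually_all.2 fun e => Ioo_mem_nhdsGT (hroom e))
  obtain ⟨t, ⟨ht₀, ht₁⟩, ht⟩ := hsmall.exists
  have hM'F := hM'.isFPM_charF
  have hmix := hM.isFPM_charF.convexCombination hM'F ht₀.le ht₁.le
  have heq := hα.2.2.2 _ hmix fun e => by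
    have hnonneg := mul_nonneg ht₀.le (hM'F.1 e)
    have hle := hα.2.2.1 e
    by_cases he : e ∈ M
    · have hone : charF M e = 1 := if_pos he
      simp only [hone] at hle ⊢
      rcases hle.lt_or_eq with hlt | heq
      · have := (ht e).2
        rw [if_pos hlt] at this
        linarith
      · have : charF M' e = 1 := if_pos (hsub (by simp [he, heq]))
        rw [this]
        linarith
    · have hzero : charF M e = 0 := if_neg he
      simp only [hzero] at hle ⊢
      linarith
  refine charF_injective (funext fun e => ?_)
  have : t * (charF M' e - charF M e) = 0 := by
    have := congrFun heq e
    linarith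
  exact sub_eq_zero.1 ((mul_eq_zero.1 this).resolve_left ht₀.ne')

theorem IsForcing.fN_le_eSum {G : SimpleGraph V} [DecidableRel G.Adj] {α : Sym2 V → ℝ}
    {M : Finset (Sym2 V)} (hM : IsPM G M) (hα : IsForcing G α (charF M)) :
    (fN G M : ℝ) ≤ eSum G α := by
  let S := M.filter fun e => α e = 1
  have hcard : fN G M ≤ S.card := Nat.sInf_le ⟨S, hα.isForcingSet hM, rfl⟩
  have hsub : S ⊆ G.edgeFinset := fun e he =>
    SimpleGraph.mem_edgeFinset.2 (hM.1 (Finset.mem_filter.1 he).1)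
  calc (fN G M : ℝ) ≤ S.card := by exact_mod_cast hcard
    _ = ∑ e ∈ S, α e := by
      rw [Finset.sum_congr rfl fun e he => (Finset.mem_filter.1 he).2, Finset.sum_const,
        nsmul_one]
    _ ≤ eSum G α := Finset.sum_le_sum_of_subset_of_nonneg hsub fun e _ _ => hα.1 e

theorem IsPM.fN_le_ffN {G : SimpleGraph V} [DecidableRel G.Adj] {M : Finset (Sym2 V)}
    (hM : IsPM G M) : (fN G M : ℝ) ≤ ffN G (charF M) := by
  refine le_csInf ⟨_, _, hM.isFPM_charF.isForcing_self, rfl⟩ ?_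
  rintro x ⟨α, hα, rfl⟩
  exact hα.fN_le_eSum hM

/-- For every graph with at least one perfect matching, `F_f(G) ≥ F(G)`. -/
theorem ffMax_ge_fMax (G : SimpleGraph V) [DecidableRel G.Adj]
    (hM : ∃ M, IsPM G M) :
    (fMax G : ℝ) ≤ ffMax G := by
  obtain ⟨M₀, hM₀⟩ := hM
  have hbdd : BddAbove {n : ℕ | ∃ M, IsPM G M ∧ fN G M = n} :=
    ((Set.toFinite {M | IsPM G M}).image (fN G)).bddAbove
  have hne : {n : ℕ | ∃ M, IsPM G M ∧ fN G M = n}.Nonempty := ⟨_, M₀, hM₀, rfl⟩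
  obtain ⟨M, hM, hmax⟩ := Nat.sSup_mem hne hbdd
  have hle : (fMax G : ℝ) ≤ ffN G (charF M) := by
    rw [fMax, ← hmax]
    exact hM.fN_le_ffN
  refine hle.trans (le_csSup ⟨Fintype.card V, ?_⟩ ⟨charF M, hM.isFPM_charF, rfl⟩)
  rintro x ⟨γ, hγ, rfl⟩
  exact hγ.ffN_le_card
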